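/- arXiv:1911.04528 — 4 statements merged into one kernel-verified Lean document; each statement's English description precedes it below -/
import Mathlib

section
/- Let F be a field and let A, B, d ∈ F with d ≠ 0. Define a sequence (K_n) in F by K_0 = d and, for n ≥ 1, K_n = A·K_{n−1} + B·(A + B·d)^{n−1}. Then for every n ≥ 0, K_n = ((A + B·d)^n + (d² − 1)·A^n)/d. -/
theorem bracket_closed_form {F : Type*} [Field F] (A B d : F) (hd : d ≠ 0)
    (K : ℕ → F) (h0 : K 0 = d)
    (hrec : ∀ n : ℕ, 1 ≤ n → K n = A * K (n - 1) + B * (A + B * d) ^ (n - 1)) :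
    ∀ n : ℕ, K n = ((A + B * d) ^ n + (d ^ 2 - 1) * A ^ n) / d := by
  intro n
  rw [eq_div_iff hd]
  induction n with
  | zero => rw [h0]; ring
  | succ n ih =>
    rw [hrec (n + 1) (Nat.le_add_left 1 n), Nat.add_sub_cancel, pow_succ, pow_succ]
    linear_combination A * ih
end

section
/- For every real number x ≠ 0 and every integer n ≥ 1, setting d = −x^{−2} − x², one has x^{3n−2} · ((x + x^{−1}·d)^n + (d² − 1)·x^n)/d = −((x^8 + x^4 + 1)·x^{4n} + (−1)^n·x^4)/(x^8 + x^4). (The paper states this identity, up to an overall sign, as the generating function of row n of OEIS A123192.) -/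
theorem normalized_bracket_A123192 (x : ℝ) (hx : x ≠ 0) (n : ℕ) (hn : 1 ≤ n) :
    x ^ (3 * n - 2) *
      (((x + x⁻¹ * (-x⁻¹ ^ 2 - x ^ 2)) ^ n +
        ((-x⁻¹ ^ 2 - x ^ 2) ^ 2 - 1) * x ^ n) / (-x⁻¹ ^ 2 - x ^ 2)) =
    -(((x ^ 8 + x ^ 4 + 1) * x ^ (4 * n) + (-1) ^ n * x ^ 4) / (x ^ 8 + x ^ 4)) := by
  have hd : -x⁻¹ ^ 2 - x ^ 2 = -((1 + x ^ 4) / x ^ 2) := by field_simp; ring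
  have hb : x + x⁻¹ * (-x⁻¹ ^ 2 - x ^ 2) = -1 / x ^ 3 := by field_simp; ring
  have hpos : 1 + x ^ 4 ≠ 0 := by positivity
  have hfactor : x ^ 8 + x ^ 4 = x ^ 4 * (1 + x ^ 4) := by ring
  have hpow : x ^ (3 * n) = x ^ (3 * n - 2) * x ^ 2 := by
    rw [← pow_add]; congr 1; omega
  have hfour : x ^ (4 * n) = x ^ (3 * n - 2) * x ^ 2 * x ^ n := by
    rw [← hpow, ← pow_add]; congr 1; omega
  rw [hb, hd, hfactor, div_pow, ← pow_mul, hpow, hfour]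
  have hk : x ^ (3 * n - 2) ≠ 0 := pow_ne_zero _ hx
  generalize x ^ (3 * n - 2) = k at hk ⊢
  generalize x ^ n = y
  generalize (-1 : ℝ) ^ n = e
  field_simp
  ring
end

section
/- For every integer n ≥ 1, the polynomial x^4·(x^4 + 1) divides the polynomial (x^8 + x^4 + 1)·x^{4n} + (−1)^n·x^4 in ℤ[x]. -/
open Polynomial in
theorem A123192_divisibility (n : ℕ) (hn : 1 ≤ n) :
    (X ^ 4 * (X ^ 4 + 1) : Polynomial ℤ) ∣
      (X ^ 8 + X ^ 4 + 1) * X ^ (4 * n) + (-1) ^ n * X ^ 4 := by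
  obtain ⟨m, rfl⟩ := Nat.exists_eq_add_of_le' hn
  obtain ⟨q, hq⟩ := sub_dvd_pow_sub_pow (X ^ 4 : Polynomial ℤ) (-1) m
  refine ⟨X ^ 4 * (X ^ 4) ^ m + q, ?_⟩
  rw [pow_mul]
  linear_combination X ^ 4 * hq
end

section
/- For every real number x ≠ 0 and every integer n ≥ 1, setting d = −x^{−2} − x², one has x^{3n−2} · ((x + x^{−1}·d)^n + (d² − 1)·x^n)/d = −x^{4n} + Σ_{j=0}^{n−2} (−1)^{n−1+j}·x^{4j}. (In particular the normalized bracket has all coefficients in {−1, 0, 1}.) -/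
theorem one_add_mul_alternating_geom_sum {R : Type*} [CommRing R] (y : R) (m : ℕ) :
    (1 + y) * ∑ j ∈ Finset.range m, (-1 : R) ^ (m + j) * y ^ j = (-1) ^ m - y ^ m := by
  induction m with
  | zero => simp
  | succ m ih =>
    have h : ∑ j ∈ Finset.range m, (-1 : R) ^ (m + 1 + j) * y ^ j =
        -∑ j ∈ Finset.range m, (-1 : R) ^ (m + j) * y ^ j := by
      rw [← Finset.sum_neg_distrib]
      exact Finset.sum_congr rfl fun j _ => by ring
    have hs : (-1 : R) ^ (m + 1 + m) = -1 := Odd.neg_one_pow ⟨m, by ring⟩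
    rw [Finset.sum_range_succ, h, hs]
    linear_combination -ih

theorem normalized_bracket_expansion (x : ℝ) (hx : x ≠ 0) (n : ℕ) (hn : 1 ≤ n) :
    x ^ (3 * n - 2) *
      (((x + x⁻¹ * (-x⁻¹ ^ 2 - x ^ 2)) ^ n +
        ((-x⁻¹ ^ 2 - x ^ 2) ^ 2 - 1) * x ^ n) / (-x⁻¹ ^ 2 - x ^ 2)) =
    -x ^ (4 * n) + ∑ j ∈ Finset.range (n - 1), (-1 : ℝ) ^ (n - 1 + j) * x ^ (4 * j) := by
  obtain ⟨m, rfl⟩ := Nat.exists_eq_add_of_le' hn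
  have hsum := one_add_mul_alternating_geom_sum (x ^ 4) m
  simp only [← pow_mul] at hsum
  rw [Nat.add_sub_cancel, show 3 * (m + 1) - 2 = 3 * m + 1 by omega]
  generalize ∑ j ∈ Finset.range m, (-1 : ℝ) ^ (m + j) * x ^ (4 * j) = S at hsum ⊢
  have hbase : x + x⁻¹ * (-x⁻¹ ^ 2 - x ^ 2) = -x⁻¹ ^ 3 := by
    field_simp
    ring
  have hd : -x⁻¹ ^ 2 - x ^ 2 ≠ 0 := by
    have : 0 < x⁻¹ ^ 2 := by positivity
    nlinarith [sq_nonneg x]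
  have hpow : x ^ (3 * m) * (-x⁻¹ ^ 3) ^ m = (-1) ^ m := by
    rw [pow_mul, ← mul_pow]
    congr 1
    field_simp
  rw [hbase, ← mul_div_assoc, div_eq_iff hd]
  have hleft : x ^ (3 * m + 1) * ((-x⁻¹ ^ 3) ^ (m + 1) +
      ((-x⁻¹ ^ 2 - x ^ 2) ^ 2 - 1) * x ^ (m + 1)) =
      -(-1) ^ m * x⁻¹ ^ 2 + ((-x⁻¹ ^ 2 - x ^ 2) ^ 2 - 1) * x ^ (4 * m) * x ^ 2 := by
    have hx1 : x * x⁻¹ ^ 3 = x⁻¹ ^ 2 := by field_simp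
    rw [← hpow, ← hx1]
    ring
  rw [hleft, show 4 * (m + 1) = 4 * m + 4 by ring, pow_add x (4 * m) 4]
  field_simp
  linear_combination hsum
end
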